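/- Let α > 0 be a noninteger real number, n = ⌊α⌋ + 1, a, b ∈ ℤ with a + 1 ≤ b − 1, and f, g : ℤ → ℝ. Then the integration by parts formula for nabla Riemann fractional differences holds: Σ_{s=a+1}^{b−1} f(s)·(∇_a^{α} g)(s) = Σ_{s=a+1}^{b−1} g(s)·(_b∇^{α} f)(s). -/

import Mathlib

/-- Backward difference operator: `(∇ f)(t) = f t − f (t−1)`. -/
def nablaOp (f : ℤ → ℝ) : ℤ → ℝ := fun t => f t - f (t - 1)

/-- Forward difference operator: `(Δ f)(t) = f (t+1) − f t`. -/
def deltaOp (f : ℤ → ℝ) : ℤ → ℝ := fun t => f (t + 1) - f t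

/-- The operator `−Δ`. -/
def negDeltaOp (f : ℤ → ℝ) : ℤ → ℝ := fun t => -(f (t + 1) - f t)

/-- Nabla left fractional sum of order `α` starting at `a`:
`(∇_a^{-α} f)(t) = (1/Γ(α)) Σ_{s=a+1}^{t} [Γ(t−s+α)/Γ(t−s+1)] f(s)`. -/
noncomputable def nablaLeftSum (a : ℤ) (α : ℝ) (f : ℤ → ℝ) : ℤ → ℝ := fun t =>
  (1 / Real.Gamma α) * ∑ s ∈ Finset.Icc (a + 1) t,
    (Real.Gamma ((t : ℝ) - (s : ℝ) + α) / Real.Gamma ((t : ℝ) - (s : ℝ) + 1)) * f s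

/-- Nabla right fractional sum of order `α` ending at `b`:
`(_b∇^{-α} f)(t) = (1/Γ(α)) Σ_{s=t}^{b−1} [Γ(s−t+α)/Γ(s−t+1)] f(s)`. -/
noncomputable def nablaRightSum (b : ℤ) (α : ℝ) (f : ℤ → ℝ) : ℤ → ℝ := fun t =>
  (1 / Real.Gamma α) * ∑ s ∈ Finset.Icc t (b - 1),
    (Real.Gamma ((s : ℝ) - (t : ℝ) + α) / Real.Gamma ((s : ℝ) - (t : ℝ) + 1)) * f s

open Finset in
/-- For a causal kernel, the upper limit of a left convolution may be enlarged. -/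
theorem sum_Icc_kernel_extend_right {k : ℤ → ℝ} (hk : ∀ m < 0, k m = 0) (g : ℤ → ℝ)
    (c : ℤ) {t T : ℤ} (h : t ≤ T) :
    ∑ s ∈ Icc c t, k (t - s) * g s = ∑ s ∈ Icc c T, k (t - s) * g s := by
  refine sum_subset (Icc_subset_Icc_right h) fun s hs hs' => ?_
  simp only [mem_Icc] at hs hs'
  rw [hk _ (by omega), zero_mul]

open Finset in
/-- For a causal kernel, the lower limit of a right convolution may be lowered. -/
theorem sum_Icc_kernel_extend_left {k : ℤ → ℝ} (hk : ∀ m < 0, k m = 0) (f : ℤ → ℝ)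
    (c : ℤ) {t T : ℤ} (h : T ≤ t) :
    ∑ s ∈ Icc t c, k (s - t) * f s = ∑ s ∈ Icc T c, k (s - t) * f s := by
  refine sum_subset (Icc_subset_Icc_left h) fun s hs hs' => ?_
  simp only [mem_Icc] at hs hs'
  rw [hk _ (by omega), zero_mul]

theorem nablaOp_eq_zero_of_neg {k : ℤ → ℝ} (hk : ∀ m < 0, k m = 0) :
    ∀ m < 0, nablaOp k m = 0 := fun m hm => by
  simp [nablaOp, hk m hm, hk (m - 1) (by omega)]

theorem nablaOp_iterate_eq_zero_of_neg (n : ℕ) {k : ℤ → ℝ} (hk : ∀ m < 0, k m = 0) :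
    ∀ m < 0, nablaOp^[n] k m = 0 := by
  induction n generalizing k with
  | zero => exact hk
  | succ n ih => exact ih (nablaOp_eq_zero_of_neg hk)

open Finset in
/-- Backward differences of a left convolution fall on the kernel. -/
theorem nablaOp_iterate_leftConv (n : ℕ) {k : ℤ → ℝ} (hk : ∀ m < 0, k m = 0)
    (g : ℤ → ℝ) (c : ℤ) :
    nablaOp^[n] (fun t => ∑ s ∈ Icc c t, k (t - s) * g s) =
      fun t => ∑ s ∈ Icc c t, nablaOp^[n] k (t - s) * g s := by
  induction n generalizing k with
  | zero => rfl
  | succ n ih =>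
    have step : nablaOp (fun t => ∑ s ∈ Icc c t, k (t - s) * g s) =
        fun t => ∑ s ∈ Icc c t, nablaOp k (t - s) * g s := by
      funext t
      simp only [nablaOp]
      rw [sum_Icc_kernel_extend_right hk g c (sub_one_lt t).le, ← sum_sub_distrib]
      refine sum_congr rfl fun s _ => ?_
      rw [sub_right_comm, sub_mul]
    rw [Function.iterate_succ_apply, step, ih (nablaOp_eq_zero_of_neg hk)]
    rfl

open Finset in
/-- Forward differences of a right convolution fall, up to sign, on the kernel as backward
differences. -/
theorem deltaOp_iterate_rightConv (n : ℕ) {k : ℤ → ℝ} (hk : ∀ m < 0, k m = 0)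
    (f : ℤ → ℝ) (c : ℤ) :
    deltaOp^[n] (fun t => ∑ s ∈ Icc t c, k (s - t) * f s) =
      fun t => (-1 : ℝ) ^ n * ∑ s ∈ Icc t c, nablaOp^[n] k (s - t) * f s := by
  induction n with
  | zero => simp
  | succ n ih =>
    rw [Function.iterate_succ_apply', ih, Function.iterate_succ']
    funext t
    simp only [deltaOp, Function.comp_apply]
    rw [sum_Icc_kernel_extend_left (nablaOp_iterate_eq_zero_of_neg n hk) f c (lt_add_one t).le,
      ← mul_sub, ← sum_sub_distrib, pow_succ, mul_assoc, neg_one_mul, ← sum_neg_distrib]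
    congr 1
    refine sum_congr rfl fun s _ => ?_
    rw [nablaOp, sub_add_eq_sub_sub]
    ring

/-- The kernel of the nabla fractional sums of order `β`. -/
noncomputable def nablaKernel (β : ℝ) (m : ℤ) : ℝ :=
  1 / Real.Gamma β * (Real.Gamma (m + β) / Real.Gamma (m + 1))

theorem nablaKernel_eq_zero_of_neg (β : ℝ) : ∀ m < 0, nablaKernel β m = 0 := fun m hm => by
  obtain ⟨j, hj⟩ := Int.eq_ofNat_of_zero_le (show 0 ≤ -(m + 1) by omega)
  have h : (m : ℝ) + 1 = -(j : ℝ) := by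
    have : m + 1 = -(j : ℤ) := by omega
    exact_mod_cast this
  rw [nablaKernel, h, Real.Gamma_neg_nat_eq_zero, div_zero, mul_zero]

theorem nablaLeftSum_eq_conv (a : ℤ) (β : ℝ) (g : ℤ → ℝ) :
    nablaLeftSum a β g =
      fun t => ∑ s ∈ Finset.Icc (a + 1) t, nablaKernel β (t - s) * g s := by
  funext t
  simp only [nablaLeftSum, nablaKernel, Finset.mul_sum, Int.cast_sub, mul_assoc]

theorem nablaRightSum_eq_conv (b : ℤ) (β : ℝ) (f : ℤ → ℝ) :
    nablaRightSum b β f =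
      fun t => ∑ s ∈ Finset.Icc t (b - 1), nablaKernel β (s - t) * f s := by
  funext t
  simp only [nablaRightSum, nablaKernel, Finset.mul_sum, Int.cast_sub, mul_assoc]

open Finset in
/-- Left and right convolution with the same causal kernel are adjoint to each other. -/
theorem sum_mul_leftConv_eq_sum_mul_rightConv {k : ℤ → ℝ} (hk : ∀ m < 0, k m = 0)
    (f g : ℤ → ℝ) (c d : ℤ) :
    ∑ t ∈ Icc c d, f t * ∑ s ∈ Icc c t, k (t - s) * g s =
      ∑ t ∈ Icc c d, g t * ∑ s ∈ Icc t d, k (s - t) * f s := by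
  calc
    _ = ∑ t ∈ Icc c d, ∑ s ∈ Icc c d, f t * (k (t - s) * g s) :=
      sum_congr rfl fun t ht => by
        rw [sum_Icc_kernel_extend_right hk g c (mem_Icc.1 ht).2, mul_sum]
    _ = ∑ s ∈ Icc c d, ∑ t ∈ Icc c d, f t * (k (t - s) * g s) := sum_comm
    _ = _ := sum_congr rfl fun s hs => by
      rw [sum_Icc_kernel_extend_left hk f d (mem_Icc.1 hs).1, mul_sum]
      exact sum_congr rfl fun t _ => by ring

theorem stmt17 (α : ℝ) (hα : 0 < α) (hαni : ∀ m : ℤ, α ≠ (m : ℝ)) (n : ℕ)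
    (hn : (n : ℤ) = ⌊α⌋ + 1) (a b : ℤ) (hab : a + 1 ≤ b - 1) (f g : ℤ → ℝ) :
    ∑ s ∈ Finset.Icc (a + 1) (b - 1),
        f s * nablaOp^[n] (nablaLeftSum a ((n : ℝ) - α) g) s =
      ∑ s ∈ Finset.Icc (a + 1) (b - 1),
        g s * ((-1 : ℝ) ^ n * deltaOp^[n] (nablaRightSum b ((n : ℝ) - α) f) s) := by
  have hk := nablaKernel_eq_zero_of_neg ((n : ℝ) - α)
  have hsign : (-1 : ℝ) ^ n * (-1) ^ n = 1 := by rw [← mul_pow]; simp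
  simp only [nablaLeftSum_eq_conv, nablaRightSum_eq_conv, nablaOp_iterate_leftConv n hk,
    deltaOp_iterate_rightConv n hk, ← mul_assoc ((-1 : ℝ) ^ n), hsign, one_mul]
  exact sum_mul_leftConv_eq_sum_mul_rightConv (nablaOp_iterate_eq_zero_of_neg n hk) f g _ _
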